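/- Let σ be a finite type (a finite set of variables). For every n ≥ 0, the n-th elementary symmetric polynomial satisfies, in MvPolynomial σ ℚ: e_n = ∑_{λ ⊢ n} ((−1)^{n − ℓ(λ)} / z_λ) · ∏_{r ∈ parts(λ)} p_r, the sum being over all partitions λ of n, where ℓ(λ) is the number of parts of λ, the product is over the parts of λ with multiplicity, and p_r is the r-th power sum. (This is the paper's formula cl_n(V) = ∑_{λ⊢n} (χ_λ(V)/z_λ) p_λ specialized to the sign representation, whose character at cycle type λ is (−1)^{n−ℓ(λ)}.) -/

import Mathlib

def zpart {n : ℕ} (p : n.Partition) : ℕ :=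
  ∏ r ∈ p.parts.toFinset, r ^ p.parts.count r * (p.parts.count r).factorial

lemma zpart_ne_zero {n : ℕ} (p : n.Partition) : zpart p ≠ 0 := by
  refine Finset.prod_ne_zero_iff.2 fun r hr => ?_
  have := p.parts_pos (Multiset.mem_toFinset.1 hr)
  positivity

lemma zpart_of_parts_eq_cons {n m a : ℕ} {p : n.Partition} {q : m.Partition}
    (h : p.parts = a ::ₘ q.parts) :
    zpart p = a * p.parts.count a * zpart q := by
  have hq : zpart q = ∏ r ∈ p.parts.toFinset,
      r ^ q.parts.count r * (q.parts.count r).factorial := by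
    refine Finset.prod_subset (fun r hr => ?_) fun r _ hr => ?_
    · simp_all
    · simp [Multiset.count_eq_zero.2 (mt Multiset.mem_toFinset.2 hr)]
  have ha : a ∈ p.parts.toFinset := by simp [h]
  have hrest : ∏ r ∈ p.parts.toFinset.erase a,
        r ^ p.parts.count r * (p.parts.count r).factorial =
      ∏ r ∈ p.parts.toFinset.erase a,
        r ^ q.parts.count r * (q.parts.count r).factorial := by
    refine Finset.prod_congr rfl fun r hr => ?_
    rw [h, Multiset.count_cons_of_ne (Finset.ne_of_mem_erase hr)]
  rw [hq, zpart, ← Finset.mul_prod_erase _ _ ha, ← Finset.mul_prod_erase _ _ ha, hrest]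
  have hc : p.parts.count a = q.parts.count a + 1 := by rw [h, Multiset.count_cons_self]
  rw [hc, Nat.factorial_succ]
  ring

lemma Nat.Partition.sum_toFinset_mul_count {n : ℕ} (p : n.Partition) :
    ∑ a ∈ p.parts.toFinset, a * p.parts.count a = n := by
  conv_rhs => rw [← p.parts_sum, Finset.sum_multiset_count]
  exact Finset.sum_congr rfl fun a _ => by rw [smul_eq_mul, mul_comm]

/-- The sum of `z_λ⁻¹ ∏_{r ∈ parts(λ)} q r` over the partitions `λ` of `n`, for an arbitrary
sequence `q`. -/
noncomputable def zpartSum {A : Type*} [CommRing A] [Algebra ℚ A] (q : ℕ → A) (n : ℕ) : A :=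
  ∑ p : n.Partition, (zpart p : ℚ)⁻¹ • (p.parts.map q).prod

section

variable {A : Type*} [CommRing A] [Algebra ℚ A] (q : ℕ → A)

lemma zpartSum_zero : zpartSum q 0 = 1 := by
  simp [zpartSum, zpart]

lemma sum_partition_with_part {n a : ℕ} (ha1 : 1 ≤ a) (ha : a ≤ n) :
    ∑ p : n.Partition with a ∈ p.parts,
        ((a * p.parts.count a : ℕ) : ℚ) • (zpart p : ℚ)⁻¹ • (p.parts.map q).prod =
      q a * zpartSum q (n - a) := by
  rw [zpartSum, Finset.mul_sum, Finset.sum_subtype (p := fun p : n.Partition => a ∈ p.parts) _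
    (by simp)]
  refine Fintype.sum_equiv (Nat.Partition.partitionWithPartEquiv ha1 ha) _ _ fun p => ?_
  set r := Nat.Partition.partitionWithPartEquiv ha1 ha p with hr
  have h : p.1.parts = a ::ₘ r.parts := by
    rw [hr, Nat.Partition.partitionWithPartEquiv_apply_parts, Multiset.cons_erase p.2]
  have hz : zpart r ≠ 0 := zpart_ne_zero r
  have hc : a * p.1.parts.count a ≠ 0 := by
    have := Multiset.count_pos.2 p.2
    positivity
  rw [zpart_of_parts_eq_cons h, smul_smul, Nat.cast_mul _ (zpart r), mul_inv,
    mul_inv_cancel_left₀ (Nat.cast_ne_zero.2 hc), h, Multiset.map_cons, Multiset.prod_cons,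
    mul_smul_comm]

lemma mul_zpartSum (n : ℕ) :
    (n : A) * zpartSum q n = ∑ a ∈ Finset.Icc 1 n, q a * zpartSum q (n - a) := by
  have hcomm : ∑ a ∈ Finset.Icc 1 n, q a * zpartSum q (n - a) =
      ∑ p : n.Partition, ∑ a ∈ p.parts.toFinset,
        ((a * p.parts.count a : ℕ) : ℚ) • (zpart p : ℚ)⁻¹ • (p.parts.map q).prod := by
    rw [← Finset.sum_comm' (s := Finset.Icc 1 n)
      (t := fun a => Finset.univ.filter fun p : n.Partition => a ∈ p.parts)]
    · refine Finset.sum_congr rfl fun a ha => ?_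
      rw [Finset.mem_Icc] at ha
      rw [sum_partition_with_part q ha.1 ha.2]
    · intro a p
      simp only [Finset.mem_Icc, Finset.mem_filter, Finset.mem_univ, true_and,
        Multiset.mem_toFinset, and_true, and_iff_right_iff_imp]
      exact fun h => ⟨p.parts_pos h, p.le_of_mem_parts h⟩
  rw [hcomm, zpartSum, Finset.mul_sum]
  refine Finset.sum_congr rfl fun p _ => ?_
  rw [← Finset.sum_smul, ← Nat.cast_sum, p.sum_toFinset_mul_count, Nat.cast_smul_eq_nsmul,
    nsmul_eq_mul]

/-- A sequence satisfying the recurrence `n h_n = ∑_{a = 1}^n q_a h_{n - a}` with `h_0 = 1` is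
given by the sum over partitions. -/
lemma eq_zpartSum_of_recurrence {h : ℕ → A} (h0 : h 0 = 1)
    (hrec : ∀ n : ℕ, (n : A) * h n = ∑ a ∈ Finset.Icc 1 n, q a * h (n - a)) (n : ℕ) :
    h n = zpartSum q n := by
  induction n using Nat.strong_induction_on with
  | _ n ih =>
    rcases Nat.eq_zero_or_pos n with rfl | hn
    · rw [h0, zpartSum_zero]
    · have key : (n : A) * h n = n * zpartSum q n := by
        rw [hrec, mul_zpartSum]
        refine Finset.sum_congr rfl fun a ha => ?_
        rw [Finset.mem_Icc] at ha
        rw [ih (n - a) (by omega)]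
      have hu : IsUnit (n : A) := by
        simpa using (IsUnit.mk0 (n : ℚ) (by positivity)).map (algebraMap ℚ A)
      exact hu.mul_left_cancel key

end

lemma MvPolynomial.mul_esymm_eq_sum_Icc (σ R : Type*) [Fintype σ] [CommRing R] (n : ℕ) :
    (n : MvPolynomial σ R) * esymm σ R n =
      ∑ a ∈ Finset.Icc 1 n, (-1) ^ (a - 1) * psum σ R a * esymm σ R (n - a) := by
  rw [mul_esymm_eq_sum, Finset.mul_sum]
  refine Finset.sum_bij' (fun a _ => a.2) (fun a _ => (n - a, a)) ?_ ?_ ?_ ?_ ?_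
  · rintro ⟨i, j⟩ h
    simp at h ⊢
    omega
  · intro a h
    simp at h ⊢
    omega
  · rintro ⟨i, j⟩ h
    simp at h ⊢
    omega
  · simp
  · rintro ⟨i, j⟩ h
    simp at h
    obtain ⟨rfl, hj⟩ := h
    obtain ⟨k, rfl⟩ : ∃ k, j = k + 1 := ⟨j - 1, by omega⟩
    have hs : (-1 : MvPolynomial σ R) ^ (i + (k + 1) + 1) * (-1) ^ i = (-1) ^ k := by
      rw [← pow_add, show i + (k + 1) + 1 + i = 2 * (i + 1) + k by ring, pow_add, pow_mul]
      simp
    simp only [Nat.add_sub_cancel]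
    rw [← hs]
    ring

lemma Multiset.prod_map_neg_one_pow_sub_one_mul {A : Type*} [CommRing A] (f : ℕ → A)
    (s : Multiset ℕ) (hs : ∀ a ∈ s, 0 < a) :
    (s.map fun a => (-1) ^ (a - 1) * f a).prod =
      (-1) ^ (s.sum - Multiset.card s) * (s.map f).prod := by
  rw [Multiset.prod_map_mul]
  congr 1
  suffices h : (s.map fun a => (-1 : A) ^ (a - 1)).prod = (-1) ^ (s.sum - Multiset.card s) ∧
      Multiset.card s ≤ s.sum from h.1
  induction s using Multiset.induction_on with
  | empty => simp
  | cons a s ih =>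
    obtain ⟨ih, hle⟩ := ih fun b hb => hs b (Multiset.mem_cons_of_mem hb)
    have ha := hs a (Multiset.mem_cons_self a s)
    simp only [Multiset.map_cons, Multiset.prod_cons, Multiset.sum_cons, Multiset.card_cons]
    refine ⟨?_, by omega⟩
    rw [ih, ← pow_add]
    congr 1
    omega

/-- `e_n = ∑_{λ ⊢ n} ((-1)^{n - ℓ(λ)}/z_λ) ∏_{r ∈ parts(λ)} p_r` in `MvPolynomial σ ℚ`. -/
theorem stmt15 (σ : Type*) [Fintype σ] [DecidableEq σ] (n : ℕ) :
    MvPolynomial.esymm σ ℚ n =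
      ∑ p : n.Partition,
        ((-1 : ℚ) ^ (n - Multiset.card p.parts) * (zpart p : ℚ)⁻¹) •
          (p.parts.map (MvPolynomial.psum σ ℚ)).prod := by
  rw [eq_zpartSum_of_recurrence (fun a => (-1) ^ (a - 1) * MvPolynomial.psum σ ℚ a)
    (MvPolynomial.esymm_zero σ ℚ) (MvPolynomial.mul_esymm_eq_sum_Icc σ ℚ) n, zpartSum]
  refine Finset.sum_congr rfl fun p _ => ?_
  rw [Multiset.prod_map_neg_one_pow_sub_one_mul _ _ fun a ha => p.parts_pos ha, p.parts_sum,
    mul_comm ((-1 : ℚ) ^ _), mul_smul]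
  congr 1
  rw [Algebra.smul_def]
  simp
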